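/- Let X be a regular curve, f : X → X a monotone continuous map, and x ∈ X_∞ = ⋂_{n ≥ 0} f^n(X). If every point of the α-limit set α_f(x) is a periodic point of f, then α_f(x) is a single periodic orbit: there is a periodic point y of f such that α_f(x) = {f^k(y) : k ≥ 0}. -/

import Mathlib

open Set Filter Metric Topology Function

/-- A regular curve: every point has arbitrarily small open neighborhoods
with finite topological boundary (to be used on a compact connected
nonempty metric space, i.e. a continuum). -/
def IsRegCurve (X : Type*) [TopologicalSpace X] : Prop :=
  ∀ (x : X) (V : Set X), IsOpen V → x ∈ V →
    ∃ U : Set X, IsOpen U ∧ x ∈ U ∧ U ⊆ V ∧ (frontier U).Finite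

/-- A monotone continuous self-map: continuous and preimages of connected
sets are connected. -/
def IsMonotoneMap {X : Type*} [TopologicalSpace X] (f : X → X) : Prop :=
  Continuous f ∧ ∀ C : Set X, IsPreconnected C → IsPreconnected (f ⁻¹' C)

/-- The ω-limit set of a point: ⋂ₙ closure {f^k(x) : k ≥ n}. -/
def omegaLimitSet {X : Type*} [TopologicalSpace X] (f : X → X) (x : X) : Set X :=
  ⋂ n : ℕ, closure ((fun k => f^[k] x) '' Set.Ici n)

/-- The α-limit set of a point: ⋂ₖ closure (⋃_{n ≥ k} f⁻ⁿ({x})). -/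
def alphaLimitSet {X : Type*} [TopologicalSpace X] (f : X → X) (x : X) : Set X :=
  ⋂ k : ℕ, closure (⋃ n ∈ Set.Ici k, f^[n] ⁻¹' {x})

/-- limsup of a sequence of sets: ⋂ₖ closure (⋃_{n ≥ k} G n). -/
def limsupSet {X : Type*} [TopologicalSpace X] (G : ℕ → Set X) : Set X :=
  ⋂ k : ℕ, closure (⋃ n ∈ Set.Ici k, G n)

/-- A minimal set of `f`: nonempty, closed, invariant, and with no proper
nonempty closed invariant subset. -/
def IsMinimalSet {X : Type*} [TopologicalSpace X] (f : X → X) (M : Set X) : Prop :=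
  M.Nonempty ∧ IsClosed M ∧ f '' M ⊆ M ∧
    ∀ A : Set X, A ⊆ M → A.Nonempty → IsClosed A → f '' A ⊆ A → A = M

/-- A periodic point of `f`. -/
def IsPeriodicPoint {X : Type*} (f : X → X) (x : X) : Prop :=
  ∃ n : ℕ, 1 ≤ n ∧ f^[n] x = x

/-- The set of limit (cluster) points of a sequence. -/
def seqLimitPoints {X : Type*} [TopologicalSpace X] (u : ℕ → X) : Set X :=
  {y : X | MapClusterPt y Filter.atTop u}

lemma aux_frontier {X : Type*} [TopologicalSpace X] {B V : Set X} (hB : IsPreconnected B)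
    (hV : IsOpen V) {a b : X} (ha : a ∈ B) (haV : a ∈ V) (hb : b ∈ B) (hbV : b ∉ V) :
    ∃ c ∈ B, c ∈ frontier V := by
  by_contra! h
  have hsub : B ⊆ V ∪ (closure V)ᶜ := by
    intro c hc
    by_cases h1 : c ∈ V
    · exact Or.inl h1
    · refine Or.inr fun h2 => h c hc ?_
      rw [hV.frontier_eq]
      exact ⟨h2, h1⟩
  obtain ⟨c, -, h1, h2⟩ := hB V (closure V)ᶜ hV isClosed_closure.isOpen_compl hsub ⟨a, ha, haV⟩
    ⟨b, hb, (hsub hb).resolve_left hbV⟩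
  exact h2 (subset_closure h1)

lemma aux_bump {X : Type*} [TopologicalSpace X] [T2Space X] [CompactSpace X] [ConnectedSpace X]
    {U : Set X} (hU : IsOpen U) (hne : (frontier U).Nonempty) {z : X} (hz : z ∈ closure U) :
    ∃ c ∈ frontier U, c ∈ connectedComponentIn (closure U) z := by
  by_contra! h
  have : CompactSpace (closure U) := isCompact_iff_compactSpace.1 isClosed_closure.isCompact
  have : Nonempty { s : Set (closure U) // IsClopen s ∧ (⟨z, hz⟩ : closure U) ∈ s } :=
    ⟨⟨univ, isClopen_univ, mem_univ _⟩⟩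
  obtain ⟨⟨D, hD, hzD⟩, hDU⟩ := exists_subset_nhds_of_isCompact
    (V := fun s : { s : Set (closure U) // IsClopen s ∧ (⟨z, hz⟩ : closure U) ∈ s } => (s : Set _))
    (U := (Subtype.val ⁻¹' (frontier U)ᶜ : Set (closure U)))
    (by
      rintro ⟨s, hs, hs'⟩ ⟨t, ht, ht'⟩
      exact ⟨⟨s ∩ t, hs.inter ht, hs', ht'⟩, inter_subset_left, inter_subset_right⟩)
    (fun s => s.2.1.1.isCompact)
    (by
      intro y hy
      rw [← connectedComponent_eq_iInter_isClopen] at hy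
      refine (isClosed_frontier.isOpen_compl.preimage continuous_subtype_val).mem_nhds ?_
      intro hy'
      refine h _ hy' ?_
      rw [connectedComponentIn_eq_image hz]
      exact ⟨y, hy, rfl⟩)
  simp only at hDU
  have hcl : IsClosed (Subtype.val '' D : Set X) :=
    (hD.1.isCompact.image continuous_subtype_val).isClosed
  have hop : IsOpen (Subtype.val '' D : Set X) := by
    obtain ⟨O, hO, rfl⟩ := isOpen_induced_iff.1 hD.2
    have : (Subtype.val '' (Subtype.val ⁻¹' O : Set (closure U)) : Set X) = O ∩ U := by
      ext y
      constructor
      · rintro ⟨y, hy, rfl⟩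
        refine ⟨hy, ?_⟩
        by_contra h1
        have := hDU hy
        apply this
        rw [hU.frontier_eq]
        exact ⟨y.2, h1⟩
      · rintro ⟨h1, h2⟩
        exact ⟨⟨y, subset_closure h2⟩, h1, rfl⟩
    rw [this]
    exact hO.inter hU
  have huniv := IsClopen.eq_univ ⟨hcl, hop⟩ ⟨z, ⟨z, hz⟩, hzD, rfl⟩
  obtain ⟨c, hc⟩ := hne
  have : c ∈ (Subtype.val '' D : Set X) := by rw [huniv]; trivial
  obtain ⟨c', hc', rfl⟩ := this
  exact hDU hc' hc

lemma aux_lc {X : Type*} [MetricSpace X] [CompactSpace X] [ConnectedSpace X]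
    (hX : IsRegCurve X) (z : X) (V : Set X) (hV : IsOpen V) (hz : z ∈ V) :
    ∃ A ∈ 𝓝 z, IsPreconnected A ∧ A ⊆ V := by
  obtain ⟨W, hW, hWc, hWV⟩ := exists_mem_nhds_isClosed_subset (hV.mem_nhds hz)
  obtain ⟨U, hU, hzU, hUW, hfin⟩ := hX z (interior W) isOpen_interior (mem_interior_iff_mem_nhds.2 hW)
  have hclV : closure U ⊆ V :=
    (closure_minimal (hUW.trans interior_subset) hWc).trans hWV
  rcases (frontier U).eq_empty_or_nonempty with he | hne
  · have : U = univ := (frontier_eq_empty_iff.1 he).resolve_left (by rintro rfl; exact hzU)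
    subst this
    refine ⟨univ, univ_mem, isPreconnected_univ, ?_⟩
    simpa using hclV
  · refine ⟨connectedComponentIn (closure U) z, ?_, isPreconnected_connectedComponentIn,
      (connectedComponentIn_subset _ _).trans hclV⟩
    have hclosed : ∀ c, IsClosed (connectedComponentIn (closure U) c) := by
      intro c
      by_cases hc : c ∈ closure U
      · have : CompactSpace (closure U) :=
          isCompact_iff_compactSpace.1 isClosed_closure.isCompact
        rw [connectedComponentIn_eq_image hc]
        exact (isClosed_connectedComponent.isCompact.image continuous_subtype_val).isClosed
      · rw [connectedComponentIn_eq_empty hc]; exact isClosed_empty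
    have hfin' : ({c ∈ frontier U | z ∉ connectedComponentIn (closure U) c}).Finite :=
      hfin.subset (sep_subset _ _)
    have hT : IsClosed (⋃ c ∈ {c ∈ frontier U | z ∉ connectedComponentIn (closure U) c},
        connectedComponentIn (closure U) c) := hfin'.isClosed_biUnion fun c _ => hclosed c
    filter_upwards [hU.mem_nhds hzU, hT.isOpen_compl.mem_nhds (x := z) (by
      simp only [mem_compl_iff, mem_iUnion, not_exists]
      rintro c ⟨_, h⟩ h'
      exact h h')] with y hyU hy
    obtain ⟨c, hc, hcy⟩ := aux_bump hU hne (subset_closure hyU)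
    have hyc : y ∈ connectedComponentIn (closure U) c := by
      rw [← connectedComponentIn_eq hcy]
      exact mem_connectedComponentIn (subset_closure hyU)
    have hzc : z ∈ connectedComponentIn (closure U) c := by
      by_contra h
      exact hy (mem_biUnion (show c ∈ {c ∈ frontier U | z ∉ connectedComponentIn (closure U) c}
        from ⟨hc, h⟩) hyc)
    rwa [← connectedComponentIn_eq hzc]

lemma aux_iter {X : Type*} [TopologicalSpace X] {f : X → X} (hf : IsMonotoneMap f) (n : ℕ)
    {C : Set X} (hC : IsPreconnected C) : IsPreconnected (f^[n] ⁻¹' C) := by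
  induction n generalizing C with
  | zero => simpa using hC
  | succ n ih =>
    rw [iterate_succ, preimage_comp]
    exact hf.2 _ (ih hC)

lemma aux_back {X : Type*} [MetricSpace X] [CompactSpace X] {f : X → X} (hf : Continuous f)
    {x : X} (hx : x ∈ ⋂ n : ℕ, Set.range (f^[n])) :
    ∃ u : ℕ → X, u 0 = x ∧ ∀ n, f (u (n + 1)) = u n := by
  have key : ∀ y : (⋂ n : ℕ, Set.range (f^[n]) : Set X), ∃ w : (⋂ n : ℕ, Set.range (f^[n]) : Set X),
      f w = y := by
    rintro ⟨y, hy⟩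
    have hr : ∀ n, IsClosed (range f^[n]) := fun n => (isCompact_range (hf.iterate n)).isClosed
    have := IsCompact.nonempty_iInter_of_sequence_nonempty_isCompact_isClosed
      (fun n => f ⁻¹' {y} ∩ range f^[n])
      (fun n => inter_subset_inter_right _ (by
        rintro _ ⟨w, rfl⟩
        exact ⟨f w, by rw [← iterate_succ_apply]⟩))
      (fun n => by
        obtain ⟨w, hw⟩ := mem_iInter.1 hy (n + 1)
        exact ⟨f^[n] w, by simpa [← iterate_succ_apply' f] using hw, w, rfl⟩)
      ((isClosed_singleton.preimage hf).inter (hr 0)).isCompact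
      (fun n => (isClosed_singleton.preimage hf).inter (hr n))
    obtain ⟨w, hw⟩ := this
    rw [mem_iInter] at hw
    exact ⟨⟨w, mem_iInter.2 fun n => (hw n).2⟩, (hw 0).1⟩
  choose g hg using key
  refine ⟨fun n => ((g^[n] ⟨x, hx⟩ : (⋂ n : ℕ, Set.range (f^[n]) : Set X)) : X), rfl, fun n => ?_⟩
  simp only [iterate_succ_apply']
  exact hg _

lemma aux_u {X : Type*} {f : X → X} {u : ℕ → X} (hu : ∀ n, f (u (n + 1)) = u n) (s n : ℕ) :
    f^[s] (u (n + s)) = u n := by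
  induction s with
  | zero => rfl
  | succ s ih => rw [iterate_succ_apply, ← add_assoc, hu, ih]

lemma aux_orbit_finite {X : Type*} {f : X → X} {y : X} (h : IsPeriodicPoint f y) :
    (range fun k : ℕ => f^[k] y).Finite := by
  obtain ⟨p, hp, hy⟩ := h
  refine ((finite_lt_nat p).image fun k => f^[k] y).subset ?_
  rintro _ ⟨k, rfl⟩
  exact ⟨k % p, Nat.mod_lt _ hp, IsPeriodicPt.iterate_mod_apply hy k⟩

lemma aux_orbit_symm {X : Type*} {f : X → X} {y : X} (h : IsPeriodicPoint f y) (k : ℕ) :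
    ∃ j, f^[j] (f^[k] y) = y := by
  obtain ⟨p, hp, hy⟩ := h
  refine ⟨k * (p - 1), ?_⟩
  rw [← iterate_add_apply]
  have : k * (p - 1) + k = k * p := by
    obtain ⟨q, rfl⟩ : ∃ q, p = q + 1 := ⟨p - 1, by omega⟩
    simp; ring
  rw [this]
  exact IsPeriodicPt.const_mul hy k

lemma aux_finite_V {X : Type*} [MetricSpace X] (hX : IsRegCurve X) {O : Set X} (hO : O.Finite)
    {W : Set X} (hW : IsOpen W) (hOW : O ⊆ W) :
    ∃ V, IsOpen V ∧ O ⊆ V ∧ V ⊆ W ∧ (frontier V).Finite := by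
  induction O, hO using Set.Finite.induction_on with
  | empty => exact ⟨∅, isOpen_empty, subset_rfl, empty_subset _, by simp⟩
  | @insert a s ha hs ih =>
    obtain ⟨V, h1, h2, h3, h4⟩ := ih ((subset_insert _ _).trans hOW)
    obtain ⟨U, g1, g2, g3, g4⟩ := hX a W hW (hOW (mem_insert _ _))
    refine ⟨U ∪ V, g1.union h1, insert_subset (Or.inl g2) (h2.trans subset_union_right),
      union_subset g3 h3, (g4.union h4).subset ?_⟩
    refine (frontier_union_subset U V).trans ?_
    exact union_subset_union inter_subset_left inter_subset_right

/-- The cluster property. -/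
def FreqAt {X : Type*} [TopologicalSpace X] (u : ℕ → X) (y : X) : Prop :=
  ∀ W : Set X, IsOpen W → y ∈ W → ∀ k, ∃ n, k ≤ n ∧ u n ∈ W

lemma aux_alpha_freq {X : Type*} [MetricSpace X] (hX : IsRegCurve X) {f : X → X}
    (hf : IsMonotoneMap f) {x : X} (hxp : ¬ IsPeriodicPoint f x) {u : ℕ → X}
    (hu0 : u 0 = x) (hu : ∀ n, f (u (n + 1)) = u n) (y : X) :
    y ∈ alphaLimitSet f x ↔ FreqAt u y := by
  have hG : ∀ n, u n ∈ f^[n] ⁻¹' {x} := fun n => by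
    have := aux_u hu n 0
    simpa [hu0] using this
  constructor
  · intro hy W hW hyW k
    by_contra! hcon
    obtain ⟨U, hU, hyU, hUW, hfin⟩ := hX y W hW hyW
    have h1 : ∀ m, ∃ n, k ≤ n ∧ m ≤ n ∧ ∃ c ∈ frontier U, f^[n] c = x := by
      intro m
      have h2 := mem_iInter.1 hy (max k m)
      obtain ⟨a, haU, ha⟩ := mem_closure_iff.1 h2 U hU hyU
      simp only [mem_iUnion] at ha
      obtain ⟨n, hn, han⟩ := ha
      have hn : max k m ≤ n := hn
      have hkn : k ≤ n := (le_max_left _ _).trans hn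
      obtain ⟨c, hc, hcU⟩ := aux_frontier (aux_iter hf n (isPreconnected_singleton (x := x))) hU
        han haU (hG n) (fun h => hcon n hkn (hUW h))
      exact ⟨n, hkn, (le_max_right _ _).trans hn, c, hcU, hc⟩
    have hinf : {n | ∃ c ∈ frontier U, f^[n] c = x}.Infinite := by
      rw [Set.infinite_iff_exists_gt]
      intro m
      obtain ⟨n, -, h, h'⟩ := h1 (m + 1)
      exact ⟨n, h', h⟩
    have hch : ∀ n : ℕ, ∃ c, n ∈ {n | ∃ c ∈ frontier U, f^[n] c = x} →
        c ∈ frontier U ∧ f^[n] c = x := by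
      intro n
      by_cases h : n ∈ {n | ∃ c ∈ frontier U, f^[n] c = x}
      · obtain ⟨c, hc⟩ := h
        exact ⟨c, fun _ => hc⟩
      · exact ⟨x, fun h' => absurd h' h⟩
    choose c hc using hch
    obtain ⟨n, hn, m, hm, hnm, heq⟩ := hinf.exists_ne_map_eq_of_mapsTo
      (f := c) (fun n hn => (hc n hn).1) hfin
    have key : ∀ n m : ℕ, n < m → f^[n] (c n) = x → f^[m] (c n) = x → False := by
      intro n m hlt e1 e2
      apply hxp
      refine ⟨m - n, by omega, ?_⟩
      conv_lhs => rw [← e1]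
      rw [← iterate_add_apply, Nat.sub_add_cancel hlt.le, e2]
    rcases lt_or_gt_of_ne hnm with h | h
    · exact key n m h (hc n hn).2 (heq ▸ (hc m hm).2)
    · exact key m n h (hc m hm).2 (heq ▸ (hc n hn).2)
  · intro h
    refine mem_iInter.2 fun k => mem_closure_iff.2 fun W hW hyW => ?_
    obtain ⟨n, hn, hnW⟩ := h W hW hyW k
    exact ⟨u n, hnW, mem_biUnion (show n ∈ Ici k from hn) (hG n)⟩

lemma aux_fin {X : Type*} [MetricSpace X] [CompactSpace X] [ConnectedSpace X]
    (hX : IsRegCurve X) {f : X → X} (hf : IsMonotoneMap f) {u : ℕ → X}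
    (hu : ∀ n, f (u (n + 1)) = u n)
    (hper : ∀ y, FreqAt u y → IsPeriodicPoint f y) : {y | FreqAt u y}.Finite := by
  by_contra hinf
  have hinf : {y | FreqAt u y}.Infinite := hinf
  obtain ⟨w, hw⟩ := hinf.exists_accPt_principal
  have hwinf : ∀ T ∈ 𝓝 w, (T ∩ {y | FreqAt u y}).Infinite := by
    intro T hT
    apply Set.Infinite.of_accPt (x := w)
    rw [accPt_iff_frequently] at hw ⊢
    refine (hw.and_eventually hT).mono ?_
    rintro y ⟨⟨h1, h2⟩, h3⟩
    exact ⟨h1, h3, h2⟩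
  have hwF : FreqAt u w := by
    intro W hW hwW k
    obtain ⟨y, hyW, hy⟩ := (hwinf W (hW.mem_nhds hwW)).nonempty
    exact hy W hW hyW k
  obtain ⟨e, he, hew⟩ := (hinf.sdiff (aux_orbit_finite (hper w hwF))).nonempty
  have heO := aux_orbit_finite (hper e he)
  have hwO : w ∉ range fun k : ℕ => f^[k] e := by
    rintro ⟨k, hk⟩
    simp only at hk
    obtain ⟨j, hj⟩ := aux_orbit_symm (hper e he) k
    exact hew ⟨j, by simp only; rw [← hk, hj]⟩
  obtain ⟨T, hT, hTc, hTO⟩ := exists_mem_nhds_isClosed_subset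
    (heO.isClosed.isOpen_compl.mem_nhds hwO)
  obtain ⟨V, hV, hOV, hVT, hVf⟩ := aux_finite_V hX heO hTc.isOpen_compl
    (fun y hy hyT => hTO hyT hy)
  obtain ⟨Z, hZ, hZcard⟩ := (hwinf T hT).exists_subset_card_eq (hVf.toFinset.card + 1)
  obtain ⟨S, hS, hSd⟩ := Z.finite_toSet.t2_separation
  have hA : ∀ z, ∃ A ∈ 𝓝 z, IsPreconnected A ∧ A ⊆ S z :=
    fun z => aux_lc hX z (S z) (hS z).2 (hS z).1
  choose A hAn hAc hAS using hA
  have hm : ∀ z, ∃ m, z ∈ Z → u m ∈ A z := by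
    intro z
    by_cases h : z ∈ Z
    · obtain ⟨m, -, hm⟩ := (hZ h).2 (interior (A z)) isOpen_interior
        (mem_interior_iff_mem_nhds.2 (hAn z)) 0
      exact ⟨m, fun _ => interior_subset hm⟩
    · exact ⟨0, fun h' => absurd h' h⟩
  choose m hm using hm
  have hp : ∀ z, ∃ p, 1 ≤ p ∧ (z ∈ Z → f^[p] z = z) := by
    intro z
    by_cases h : z ∈ Z
    · obtain ⟨p, h1, h2⟩ := hper z (hZ h).2
      exact ⟨p, h1, fun _ => h2⟩
    · exact ⟨1, le_rfl, fun h' => absurd h' h⟩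
  choose q hq1 hq using hp
  set p := ∏ z ∈ Z, q z with hpdef
  have hp1 : 0 < p := Finset.prod_pos fun z _ => hq1 z
  have hpz : ∀ k, ∀ z ∈ Z, f^[k * p] z = z := by
    intro k z hz
    obtain ⟨r, hr⟩ := (Finset.dvd_prod_of_mem q hz).mul_left k
    rw [hpdef, hr, mul_comm]
    exact IsPeriodicPt.const_mul (hq z hz) r
  set M := Z.sup m with hM
  have hmM : ∀ z ∈ Z, m z ≤ M := fun z hz => Finset.le_sup hz
  obtain ⟨n, hn, hnV⟩ := he (⋂ s ∈ Iic (M + p), f^[s] ⁻¹' V)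
    ((finite_Iic _).isOpen_biInter fun s _ => hV.preimage (hf.1.iterate s))
    (mem_iInter₂.2 fun s _ => hOV ⟨s, rfl⟩) M
  set k := (n - M) / p with hk
  have hk1 : k * p ≤ n - M := Nat.div_mul_le_self _ _
  have hk2 : n - M < k * p + p := by
    have := Nat.lt_div_mul_add (a := n - M) (b := p) hp1
    simpa [hk] using this
  have hc : ∀ z, ∃ c, z ∈ Z → c ∈ frontier V ∧ f^[k * p] c ∈ A z := by
    intro z
    by_cases hz : z ∈ Z
    · have hle := hmM z hz
      have hV1 : u (m z + k * p) ∈ V := by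
        obtain ⟨s, hs⟩ : ∃ s, n = m z + k * p + s := ⟨n - (m z + k * p), by omega⟩
        have h1 := mem_iInter₂.1 hnV s (by simp only [mem_Iic]; omega)
        rw [mem_preimage, hs, aux_u hu] at h1
        exact h1
      obtain ⟨c, hc1, hc2⟩ := aux_frontier (aux_iter hf (k * p) (hAc z)) hV
        (a := u (m z + k * p)) (b := z)
        (by rw [mem_preimage, aux_u hu]; exact hm z hz) hV1
        (by rw [mem_preimage, hpz k z hz]; exact mem_of_mem_nhds (hAn z))
        (fun h => hVT h (hZ hz).1)
      exact ⟨c, fun _ => ⟨hc2, hc1⟩⟩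
    · exact ⟨z, fun h => absurd h hz⟩
  choose c hc using hc
  have hcard : Z.card ≤ hVf.toFinset.card := by
    refine Finset.card_le_card_of_injOn c (fun z hz => ?_) ?_
    · simpa using (hc z hz).1
    · intro z hz z' hz' heq
      by_contra hne
      have h1 := hAS z (hc z hz).2
      have h2 := hAS z' (hc z' hz').2
      rw [heq] at h1
      exact disjoint_left.1 (hSd hz hz' hne) h1 h2
  omega

theorem stmt_19 {X : Type*} [MetricSpace X] [CompactSpace X] [ConnectedSpace X]
    (hX : IsRegCurve X) (f : X → X) (hf : IsMonotoneMap f) (x : X)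
    (hx : x ∈ ⋂ n : ℕ, Set.range (f^[n]))
    (hper : ∀ y ∈ alphaLimitSet f x, IsPeriodicPoint f y) :
    ∃ y : X, IsPeriodicPoint f y ∧
      alphaLimitSet f x = Set.range (fun k : ℕ => f^[k] y) := by
  by_cases hxp : IsPeriodicPoint f x
  · refine ⟨x, hxp, ?_⟩
    have hfin := aux_orbit_finite hxp
    obtain ⟨p, hp, hfx⟩ := id hxp
    have hjp : ∀ j, f^[j * p] x = x := fun j => IsPeriodicPt.const_mul hfx j
    have hsub : ∀ n y, f^[n] y = x → y ∈ alphaLimitSet f x := by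
      intro n y hy
      refine mem_iInter.2 fun k => subset_closure ?_
      refine mem_biUnion (show k * p + n ∈ Ici k from ?_) ?_
      · have := Nat.le_mul_of_pos_right k hp
        simp only [mem_Ici]; omega
      · rw [mem_preimage, iterate_add_apply, hy, hjp]; rfl
    apply Subset.antisymm
    · intro y hy
      have h0 := mem_iInter.1 hy 0
      refine closure_minimal ?_ hfin.isClosed h0
      intro z hz
      simp only [mem_iUnion] at hz
      obtain ⟨n, -, hz⟩ := hz
      have hz : f^[n] z = x := hz
      obtain ⟨j, hj⟩ := aux_orbit_symm (hper z (hsub n z hz)) n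
      exact ⟨j, by simp only; rw [← hz, hj]⟩
    · rintro _ ⟨k, rfl⟩
      obtain ⟨j, hj⟩ := aux_orbit_symm hxp k
      exact hsub j _ hj
  · obtain ⟨u, hu0, hu⟩ := aux_back hf.1 hx
    have hiff := aux_alpha_freq hX hf hxp hu0 hu
    have hper' : ∀ y, FreqAt u y → IsPeriodicPoint f y := fun y hy => hper y ((hiff y).2 hy)
    have hfin := aux_fin hX hf hu hper'
    have hset : alphaLimitSet f x = {y | FreqAt u y} := by
      ext y; exact hiff y
    rw [hset]
    have hstep : ∀ y, FreqAt u y → FreqAt u (f y) := by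
      intro y hy W hW hyW k
      obtain ⟨n, hn, hnW⟩ := hy (f ⁻¹' W) (hW.preimage hf.1) hyW (k + 1)
      obtain ⟨n, rfl⟩ : ∃ n', n = n' + 1 := ⟨n - 1, by omega⟩
      exact ⟨n, by omega, by rw [mem_preimage, hu] at hnW; exact hnW⟩
    have hev : ∀ W : Set X, IsOpen W → {y | FreqAt u y} ⊆ W → ∃ k, ∀ n, k ≤ n → u n ∈ W := by
      intro W hW hsub
      by_contra! hcon
      obtain ⟨y, hyW, hy⟩ := hW.isClosed_compl.isCompact.exists_mapClusterPt_of_frequently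
        (f := u) (l := atTop) (frequently_atTop.2 fun k => by
          obtain ⟨n, h1, h2⟩ := hcon k
          exact ⟨n, h1, h2⟩)
      refine hyW (hsub ?_)
      intro W' hW' hyW' k
      obtain ⟨n, h1, h2⟩ := frequently_atTop.1 (hy.frequently (hW'.mem_nhds hyW')) k
      exact ⟨n, h1, h2⟩
    have hne : ∃ a, FreqAt u a := by
      by_contra! hcon
      obtain ⟨k, hk⟩ := hev ∅ isOpen_empty (fun y hy => hcon y hy)
      exact hk k le_rfl
    obtain ⟨a, ha⟩ := hne
    refine ⟨a, hper' a ha, ?_⟩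
    have hsubP : (range fun k : ℕ => f^[k] a) ⊆ {y | FreqAt u y} := by
      rintro _ ⟨k, rfl⟩
      induction k with
      | zero => exact ha
      | succ k ih =>
        simp only [iterate_succ_apply']
        exact hstep _ ih
    refine Subset.antisymm ?_ hsubP
    intro b hb
    by_contra hbP
    set P := range fun k : ℕ => f^[k] a with hP
    have hPfin : P.Finite := hfin.subset hsubP
    have hQfin : ({y | FreqAt u y} \ P).Finite := hfin.sdiff
    have hPf : ∀ y ∈ P, f y ∈ P := by
      rintro _ ⟨k, rfl⟩
      exact ⟨k + 1, by simp only [iterate_succ_apply']⟩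
    have hPf' : ∀ j, ∀ y ∈ P, f^[j] y ∈ P := by
      intro j
      induction j with
      | zero => exact fun y hy => hy
      | succ j ih => intro y hy; rw [iterate_succ_apply]; exact ih _ (hPf y hy)
    have hQf : ∀ y ∈ {y | FreqAt u y} \ P, f y ∈ {y | FreqAt u y} \ P := by
      rintro y ⟨hy, hyP⟩
      refine ⟨hstep y hy, fun h => hyP ?_⟩
      obtain ⟨j, hj⟩ := aux_orbit_symm (hper' y hy) 1
      rw [← hj]
      exact hPf' j _ h
    obtain ⟨U, V, hU, hV, hPU, hQV, hUV⟩ := SeparatedNhds.of_isCompact_isCompact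
      hPfin.isCompact hQfin.isCompact disjoint_sdiff_right
    have hU' : IsOpen (U ∩ f ⁻¹' U) := hU.inter (hU.preimage hf.1)
    have hV' : IsOpen (V ∩ f ⁻¹' V) := hV.inter (hV.preimage hf.1)
    have hPU' : P ⊆ U ∩ f ⁻¹' U := fun y hy => ⟨hPU hy, hPU (hPf y hy)⟩
    have hQV' : {y | FreqAt u y} \ P ⊆ V ∩ f ⁻¹' V := fun y hy => ⟨hQV hy, hQV (hQf y hy)⟩
    obtain ⟨k, hk⟩ := hev ((U ∩ f ⁻¹' U) ∪ (V ∩ f ⁻¹' V)) (hU'.union hV') (by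
      intro y hy
      by_cases hyP : y ∈ P
      · exact Or.inl (hPU' hyP)
      · exact Or.inr (hQV' ⟨hy, hyP⟩))
    obtain ⟨n, hn, hnV⟩ := hb _ hV' (hQV' ⟨hb, hbP⟩) k
    obtain ⟨l, hl, hlU⟩ := ha _ hU' (hPU' ⟨0, rfl⟩) n
    have hback : ∀ d, n + d ≤ l → u (l - d) ∈ U ∩ f ⁻¹' U := by
      intro d
      induction d with
      | zero => intro _; exact hlU
      | succ d ih =>
        intro hd
        have h1 := (ih (by omega)).2
        have h2 : l - d = (l - (d + 1)) + 1 := by omega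
        rw [mem_preimage, h2, hu] at h1
        rcases hk (l - (d + 1)) (by omega) with h3 | h3
        · exact h3
        · exact absurd h3.1 (disjoint_left.1 hUV h1)
    have h1 := hback (l - n) (by omega)
    rw [show l - (l - n) = n by omega] at h1
    exact disjoint_left.1 hUV h1.1 hnV.1
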